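/- Let X be a complex Banach space, p > 0, let (I,‖·‖_I) be an l_p-ideal in B(X), let det_{p,I}(I−·) : I → ℂ be the unique ‖·‖_I-continuous function with det_{p,I}(I−F) = det_p(I−F) for all F ∈ F(X), and let L ∈ I. Then det_{p,I}(I−L) ≠ 0 if and only if I−L is invertible in B(X). -/

import Mathlib

open scoped ENNReal

variable {X : Type*} [NormedAddCommGroup X] [NormedSpace ℂ X] [CompleteSpace X]

/-- A continuous linear operator has finite rank. -/
def IsFiniteRank (F : X →L[ℂ] X) : Prop :=
  FiniteDimensional ℂ (LinearMap.range (F : X →ₗ[ℂ] X))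

/-- `det(I - F)`, defined as the determinant of the restriction of `I - F` to the
(finite-dimensional) range of `F`. -/
noncomputable def detOneSub (F : X →L[ℂ] X) : ℂ :=
  LinearMap.det
    ((LinearMap.id : LinearMap.range (F : X →ₗ[ℂ] X) →ₗ[ℂ] LinearMap.range (F : X →ₗ[ℂ] X)) -
      (F : X →ₗ[ℂ] X).restrict fun x _ => LinearMap.mem_range_self _ x)

/-- `tr F`, the trace of the restriction of `F` to its range. -/
noncomputable def trOn (F : X →L[ℂ] X) : ℂ :=
  LinearMap.trace ℂ (LinearMap.range (F : X →ₗ[ℂ] X))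
    ((F : X →ₗ[ℂ] X).restrict fun x _ => LinearMap.mem_range_self _ x)

/-- The `p`-regularized determinant `det_p(I-F)` of a finite rank operator. -/
noncomputable def detp (p : ℝ) (F : X →L[ℂ] X) : ℂ :=
  detOneSub F * Complex.exp (∑ k ∈ Finset.Icc 1 (⌈p⌉₊ - 1), trOn (F ^ k) / (k : ℂ))

open scoped ENNReal

variable {X : Type*} [NormedAddCommGroup X] [NormedSpace ℂ X] [CompleteSpace X]

/-- The Riesz projection of `T` at `μ`, computed with the circle of radius `r` around `μ`. -/
noncomputable def rieszProjection (T : X →L[ℂ] X) (μ : ℂ) (r : ℝ) : X →L[ℂ] X :=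
  (2 * Real.pi * Complex.I)⁻¹ • ∮ z in C(μ, r), resolvent T z

/-- `μ` is a discrete eigenvalue of `T`: an isolated point of the spectrum whose
Riesz projection has finite-dimensional range. -/
def IsDiscreteEigenvalue (T : X →L[ℂ] X) (μ : ℂ) : Prop :=
  μ ∈ spectrum ℂ T ∧ ∃ r, 0 < r ∧
    (∀ z ∈ Metric.closedBall μ r, z ≠ μ → z ∉ spectrum ℂ T) ∧
    FiniteDimensional ℂ (LinearMap.range ((rieszProjection T μ r : X →L[ℂ] X) : X →ₗ[ℂ] X))

open scoped Classical in
/-- The algebraic multiplicity of `μ`: the dimension of the range of the Riesz projection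
computed with a radius isolating `μ` from the rest of the spectrum. -/
noncomputable def algebraicMultiplicity (T : X →L[ℂ] X) (μ : ℂ) : ℕ :=
  if h : ∃ r, 0 < r ∧ ∀ z ∈ Metric.closedBall μ r, z ≠ μ → z ∉ spectrum ℂ T then
    Module.finrank ℂ (LinearMap.range ((rieszProjection T μ h.choose : X →L[ℂ] X) : X →ₗ[ℂ] X))
  else 0

/-- `∑_j |λ_j(T)|^p`, the sum over the discrete eigenvalues of `T`, counted with
algebraic multiplicity (as an extended nonnegative real). -/
noncomputable def eigSum (p : ℝ) (T : X →L[ℂ] X) : ℝ≥0∞ :=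
  ∑' μ : {μ : ℂ // IsDiscreteEigenvalue T μ},
    (algebraicMultiplicity T (μ : ℂ) : ℝ≥0∞) * ENNReal.ofReal (‖(μ : ℂ)‖ ^ p)

/-- The number of discrete eigenvalues of `T` in the set `S`, counted with algebraic
multiplicity (as an extended nonnegative real). -/
noncomputable def eigCount (T : X →L[ℂ] X) (S : Set ℂ) : ℝ≥0∞ :=
  ∑' μ : {μ : ℂ // μ ∈ S ∧ IsDiscreteEigenvalue T μ},
    (algebraicMultiplicity T (μ : ℂ) : ℝ≥0∞)

/-- An `l_p`-ideal in `B(X)`: a quasi-normed subspace (with quasi-norm `norm'` and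
quasi-triangle constant `q`) of the bounded operators on `X` in which the finite rank
operators are dense (A1), whose quasi-norm dominates the operator norm (A2), which is a
two-sided ideal with submultiplicative quasi-norm (A3), and whose members have
`l_p`-summable discrete eigenvalue sequences, with eigenvalue constant `γ` (A4). -/
structure LpIdeal (p : ℝ) (X : Type*) [NormedAddCommGroup X] [NormedSpace ℂ X]
    [CompleteSpace X] where
  carrier : Set (X →L[ℂ] X)
  norm' : (X →L[ℂ] X) → ℝ
  q : ℝ
  γ : ℝ
  one_le_q : 1 ≤ q
  γ_nonneg : 0 ≤ γ
  add_mem : ∀ {K L : X →L[ℂ] X}, K ∈ carrier → L ∈ carrier → K + L ∈ carrier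
  smul_mem : ∀ (c : ℂ) {L : X →L[ℂ] X}, L ∈ carrier → c • L ∈ carrier
  norm'_nonneg : ∀ L ∈ carrier, 0 ≤ norm' L
  norm'_eq_zero_iff : ∀ L ∈ carrier, (norm' L = 0 ↔ L = 0)
  norm'_smul : ∀ L ∈ carrier, ∀ c : ℂ, norm' (c • L) = ‖c‖ * norm' L
  norm'_add_le : ∀ K ∈ carrier, ∀ L ∈ carrier, norm' (K + L) ≤ q * (norm' K + norm' L)
  finiteRank_mem : ∀ F : X →L[ℂ] X, IsFiniteRank F → F ∈ carrier
  dense_finiteRank : ∀ L ∈ carrier, ∀ ε > 0, ∃ F : X →L[ℂ] X, IsFiniteRank F ∧ norm' (L - F) < ε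
  opNorm_le : ∀ L ∈ carrier, ‖L‖ ≤ norm' L
  mul_mem : ∀ L ∈ carrier, ∀ A B : X →L[ℂ] X, A * L * B ∈ carrier
  mul_norm'_le : ∀ L ∈ carrier, ∀ A B : X →L[ℂ] X, norm' (A * L * B) ≤ ‖A‖ * norm' L * ‖B‖
  eig_le : ∀ L ∈ carrier, eigSum p L ≤ ENNReal.ofReal ((γ * norm' L) ^ p)

/-- `D` is continuous on the ideal `I` with respect to the quasi-norm of `I`. -/
def IdealContinuous {p : ℝ} (I : LpIdeal p X) (D : (X →L[ℂ] X) → ℂ) : Prop :=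
  ∀ L ∈ I.carrier, ∀ ε > 0, ∃ δ > 0, ∀ K ∈ I.carrier, I.norm' (K - L) < δ → ‖D K - D L‖ < ε

/-- `D` agrees with the `p`-regularized determinant on the finite rank operators. -/
def ExtendsDetp (p : ℝ) (D : (X →L[ℂ] X) → ℂ) : Prop :=
  ∀ F : X →L[ℂ] X, IsFiniteRank F → D F = detp p F

/-- Weinstein–Aronszajn identity for linear maps between finite-dimensional spaces. -/
theorem LinearMap.det_id_sub_comp_comm {K V W : Type*} [Field K] [AddCommGroup V] [Module K V]
    [FiniteDimensional K V] [AddCommGroup W] [Module K W] [FiniteDimensional K W]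
    (f : V →ₗ[K] W) (g : W →ₗ[K] V) :
    LinearMap.det (LinearMap.id - g ∘ₗ f) = LinearMap.det (LinearMap.id - f ∘ₗ g) := by
  classical
  let b := Module.finBasis K V
  let c := Module.finBasis K W
  rw [← LinearMap.det_toMatrix b, ← LinearMap.det_toMatrix c, map_sub, map_sub,
    LinearMap.toMatrix_comp b c b, LinearMap.toMatrix_comp c b c, LinearMap.toMatrix_id,
    LinearMap.toMatrix_id, Matrix.det_one_sub_mul_comm]

theorem detOneSub_eq_det_restrict {F : X →L[ℂ] X} (W : Submodule ℂ X) [FiniteDimensional ℂ W]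
    (hF : ∀ x, F x ∈ W) :
    detOneSub F =
      LinearMap.det (LinearMap.id - (F : X →ₗ[ℂ] X).restrict (p := W) fun x _ => hF x) := by
  have hle : LinearMap.range (F : X →ₗ[ℂ] X) ≤ W := by
    rintro _ ⟨x, rfl⟩
    exact hF x
  have : FiniteDimensional ℂ (LinearMap.range (F : X →ₗ[ℂ] X)) :=
    Submodule.finiteDimensional_of_le hle
  exact LinearMap.det_id_sub_comp_comm (Submodule.inclusion hle)
    ((F : X →ₗ[ℂ] X).rangeRestrict ∘ₗ W.subtype)

theorem trOn_eq_trace_restrict {F : X →L[ℂ] X} (W : Submodule ℂ X) [FiniteDimensional ℂ W]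
    (hF : ∀ x, F x ∈ W) :
    trOn F = LinearMap.trace ℂ W ((F : X →ₗ[ℂ] X).restrict (p := W) fun x _ => hF x) := by
  have hle : LinearMap.range (F : X →ₗ[ℂ] X) ≤ W := by
    rintro _ ⟨x, rfl⟩
    exact hF x
  have : FiniteDimensional ℂ (LinearMap.range (F : X →ₗ[ℂ] X)) :=
    Submodule.finiteDimensional_of_le hle
  exact LinearMap.trace_comp_comm' (R := ℂ) (Submodule.inclusion hle)
    ((F : X →ₗ[ℂ] X).rangeRestrict ∘ₗ W.subtype)

theorem isFiniteRank_of_forall_mem {F : X →L[ℂ] X} (W : Submodule ℂ X) [FiniteDimensional ℂ W]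
    (hF : ∀ x, F x ∈ W) : IsFiniteRank F := by
  have hle : LinearMap.range (F : X →ₗ[ℂ] X) ≤ W := by
    rintro _ ⟨x, rfl⟩
    exact hF x
  exact Submodule.finiteDimensional_of_le hle

/-- The trace is bounded on the operators on a finite-dimensional normed space. -/
theorem exists_norm_trace_le (E : Type*) [NormedAddCommGroup E] [NormedSpace ℂ E]
    [FiniteDimensional ℂ E] :
    ∃ C, 0 ≤ C ∧ ∀ T : E →L[ℂ] E, ‖LinearMap.trace ℂ E (T : E →ₗ[ℂ] E)‖ ≤ C * ‖T‖ := by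
  let τ : (E →L[ℂ] E) →L[ℂ] ℂ := LinearMap.toContinuousLinearMap
    (LinearMap.trace ℂ E ∘ₗ ContinuousLinearMap.coeLM ℂ)
  exact ⟨‖τ‖, norm_nonneg τ, τ.le_opNorm⟩

theorem ContinuousLinearMap.norm_pow_le_pow_norm {𝕜 E : Type*} [NontriviallyNormedField 𝕜]
    [SeminormedAddCommGroup E] [NormedSpace 𝕜 E] (T : E →L[𝕜] E) (n : ℕ) :
    ‖T ^ n‖ ≤ ‖T‖ ^ n := by
  rcases n.eq_zero_or_pos with rfl | hn
  · rw [pow_zero, pow_zero]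
    exact ContinuousLinearMap.norm_id_le
  · exact norm_pow_le' T hn

namespace IsFiniteRank

variable {A B : X →L[ℂ] X}

theorem mul_right (hA : IsFiniteRank A) (B : X →L[ℂ] X) : IsFiniteRank (A * B) :=
  have : FiniteDimensional ℂ (LinearMap.range (A : X →ₗ[ℂ] X)) := hA
  isFiniteRank_of_forall_mem _ fun x => LinearMap.mem_range_self (A : X →ₗ[ℂ] X) (B x)

theorem mul_left (hB : IsFiniteRank B) (A : X →L[ℂ] X) : IsFiniteRank (A * B) :=
  have : FiniteDimensional ℂ (LinearMap.range (B : X →ₗ[ℂ] X)) := hB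
  isFiniteRank_of_forall_mem ((LinearMap.range (B : X →ₗ[ℂ] X)).map (A : X →ₗ[ℂ] X)) fun x =>
    Submodule.mem_map_of_mem (LinearMap.mem_range_self (B : X →ₗ[ℂ] X) x)

/-- Two finite rank operators map into a common finite-dimensional subspace. -/
theorem exists_common_range (hA : IsFiniteRank A) (hB : IsFiniteRank B) :
    ∃ W : Submodule ℂ X, FiniteDimensional ℂ W ∧ (∀ x, A x ∈ W) ∧ ∀ x, B x ∈ W := by
  have : FiniteDimensional ℂ (LinearMap.range (A : X →ₗ[ℂ] X)) := hA
  have : FiniteDimensional ℂ (LinearMap.range (B : X →ₗ[ℂ] X)) := hB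
  exact ⟨LinearMap.range (A : X →ₗ[ℂ] X) ⊔ LinearMap.range (B : X →ₗ[ℂ] X), inferInstance,
    fun x => Submodule.mem_sup_left (LinearMap.mem_range_self (A : X →ₗ[ℂ] X) x),
    fun x => Submodule.mem_sup_right (LinearMap.mem_range_self (B : X →ₗ[ℂ] X) x)⟩

theorem add (hA : IsFiniteRank A) (hB : IsFiniteRank B) : IsFiniteRank (A + B) := by
  obtain ⟨W, _, h₁, h₂⟩ := hA.exists_common_range hB
  exact isFiniteRank_of_forall_mem W fun x => W.add_mem (h₁ x) (h₂ x)

theorem sub (hA : IsFiniteRank A) (hB : IsFiniteRank B) : IsFiniteRank (A - B) := by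
  obtain ⟨W, _, h₁, h₂⟩ := hA.exists_common_range hB
  exact isFiniteRank_of_forall_mem W fun x => W.sub_mem (h₁ x) (h₂ x)

theorem isCompactOperator (hA : IsFiniteRank A) : IsCompactOperator A := by
  have : FiniteDimensional ℂ (LinearMap.range (A : X →ₗ[ℂ] X)) := hA
  have : LocallyCompactSpace (LinearMap.range (A : X →ₗ[ℂ] X)) :=
    have := FiniteDimensional.proper ℂ (LinearMap.range (A : X →ₗ[ℂ] X))
    inferInstance
  exact (isCompactOperator_of_locallyCompactSpace_dom
    (A.codRestrict _ fun x => LinearMap.mem_range_self (A : X →ₗ[ℂ] X) x)).clm_comp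
      (LinearMap.range (A : X →ₗ[ℂ] X)).subtypeL

theorem trOn_add (hA : IsFiniteRank A) (hB : IsFiniteRank B) :
    trOn (A + B) = trOn A + trOn B := by
  obtain ⟨W, _, h₁, h₂⟩ := hA.exists_common_range hB
  rw [trOn_eq_trace_restrict W h₁, trOn_eq_trace_restrict W h₂,
    trOn_eq_trace_restrict W fun x => W.add_mem (h₁ x) (h₂ x), ← map_add]
  rfl

theorem trOn_mul_comm (hA : IsFiniteRank A) (B : X →L[ℂ] X) : trOn (A * B) = trOn (B * A) := by
  let R := LinearMap.range (A : X →ₗ[ℂ] X)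
  let S := R.map (B : X →ₗ[ℂ] X)
  have : FiniteDimensional ℂ R := hA
  have hAR : ∀ x, A x ∈ R := fun x => LinearMap.mem_range_self (A : X →ₗ[ℂ] X) x
  have hBS : ∀ x ∈ R, B x ∈ S := fun x hx => Submodule.mem_map_of_mem hx
  rw [trOn_eq_trace_restrict (F := A * B) R fun x => hAR (B x),
    trOn_eq_trace_restrict (F := B * A) S fun x => hBS _ (hAR x)]
  exact LinearMap.trace_comp_comm' (R := ℂ) ((B : X →ₗ[ℂ] X).restrict hBS)
    ((A : X →ₗ[ℂ] X).restrict fun x _ => hAR x)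

/-- `det ((I - A) (I - B)) = det (I - A) * det (I - B)`. -/
theorem detOneSub_mul (hA : IsFiniteRank A) (hB : IsFiniteRank B) :
    detOneSub (A + B - A * B) = detOneSub A * detOneSub B := by
  obtain ⟨W, _, h₁, h₂⟩ := hA.exists_common_range hB
  rw [detOneSub_eq_det_restrict W h₁, detOneSub_eq_det_restrict W h₂,
    detOneSub_eq_det_restrict W fun x => W.sub_mem (W.add_mem (h₁ x) (h₂ x)) (h₁ (B x)),
    ← LinearMap.det_comp]
  congr 1
  ext x
  simp [LinearMap.restrict_apply]
  abel

theorem detOneSub_eq_zero_iff (hA : IsFiniteRank A) : detOneSub A = 0 ↔ ∃ x ≠ 0, A x = x := by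
  have : FiniteDimensional ℂ (LinearMap.range (A : X →ₗ[ℂ] X)) := hA
  rw [detOneSub, LinearMap.det_eq_zero_iff_ker_ne_bot, Submodule.ne_bot_iff]
  constructor
  · rintro ⟨x, hx, hx0⟩
    refine ⟨x, by simpa using hx0, ?_⟩
    exact (sub_eq_zero.1 (congrArg Subtype.val (LinearMap.mem_ker.1 hx))).symm
  · rintro ⟨x, hx0, hx⟩
    refine ⟨⟨x, x, hx⟩, ?_, fun h => hx0 (congrArg Subtype.val h)⟩
    rw [LinearMap.mem_ker]
    ext
    simp [hx]

/-- For a fixed finite rank `A`, the functional `S ↦ tr (A S)` is bounded. -/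
theorem exists_norm_trOn_mul_le (hA : IsFiniteRank A) :
    ∃ C, 0 ≤ C ∧ ∀ S : X →L[ℂ] X, ‖trOn (A * S)‖ ≤ C * ‖S‖ := by
  let R := LinearMap.range (A : X →ₗ[ℂ] X)
  have : FiniteDimensional ℂ R := hA
  have hAR : ∀ x, A x ∈ R := fun x => LinearMap.mem_range_self (A : X →ₗ[ℂ] X) x
  let A' : X →L[ℂ] R := A.codRestrict R hAR
  obtain ⟨c, hc, hle⟩ := exists_norm_trace_le R
  refine ⟨c * (‖A'‖ * ‖R.subtypeL‖), by positivity, fun S => ?_⟩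
  have h : trOn (A * S) = LinearMap.trace ℂ R (A' ∘L S ∘L R.subtypeL : R →L[ℂ] R) :=
    trOn_eq_trace_restrict (F := A * S) R fun x => hAR (S x)
  calc ‖trOn (A * S)‖ ≤ c * ‖A' ∘L S ∘L R.subtypeL‖ := h ▸ hle _
    _ ≤ c * (‖A'‖ * (‖S‖ * ‖R.subtypeL‖)) := by
      gcongr
      exact (A'.opNorm_comp_le _).trans (by gcongr; exact S.opNorm_comp_le _)
    _ = _ := by ring

/-- If `I - G = (I - F) (I - K)` with `F` fixed of finite rank, then `tr (G ^ k) - tr (K ^ k)` is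
bounded as long as `G` and `K` are. -/
theorem exists_norm_trOn_pow_mul_sub_le {F : X →L[ℂ] X} (hF : IsFiniteRank F) (m : ℝ) (k : ℕ) :
    ∀ b : ℝ, ∃ C, ∀ G K S : X →L[ℂ] X, IsFiniteRank G → IsFiniteRank K → G = F + K - F * K →
      ‖G‖ ≤ m → ‖K‖ ≤ m → ‖S‖ ≤ b → ‖trOn (G ^ k * S) - trOn (K ^ k * S)‖ ≤ C := by
  obtain ⟨c, hc, hcF⟩ := hF.exists_norm_trOn_mul_le
  induction k with
  | zero => exact fun b => ⟨0, by simp⟩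
  | succ k ih =>
    intro b
    obtain ⟨C, hC⟩ := ih (m * b)
    refine ⟨c * ((b + m * b) * m ^ k) + C, fun G K S hG hK h hGm hKm hS => ?_⟩
    have hm : 0 ≤ m := (norm_nonneg G).trans hGm
    have hKS : ‖K * S‖ ≤ m * b := (norm_mul_le K S).trans (by gcongr)
    have hFR := hF.mul_right (S - K * S)
    have hsplit : G ^ (k + 1) * S = G ^ k * (F * (S - K * S)) + G ^ k * (K * S) := by
      rw [← mul_add, pow_succ, mul_assoc]
      congr 1
      rw [h]
      noncomm_ring
    have hbound : ‖trOn (G ^ k * (F * (S - K * S)))‖ ≤ c * ((b + m * b) * m ^ k) := by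
      rw [← hFR.trOn_mul_comm, mul_assoc]
      refine (hcF _).trans (mul_le_mul_of_nonneg_left ((norm_mul_le _ _).trans ?_) hc)
      gcongr
      · exact (norm_nonneg _).trans (norm_sub_le_of_le hS hKS)
      · exact norm_sub_le_of_le hS hKS
      · exact (G.norm_pow_le_pow_norm k).trans (by gcongr)
    rw [hsplit, (hFR.mul_left _).trOn_add ((hK.mul_right S).mul_left _), pow_succ, mul_assoc,
      add_sub_assoc]
    exact norm_add_le_of_le hbound (hC G K (K * S) hG hK h hGm hKm hKS)

/-- If `I - G = (I - F) (I - K)` with `F` fixed of finite rank and `I - F` injective, then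
`det_p (I - G)` is bounded below by a multiple of `det_p (I - K)` as long as `G` and `K` stay
bounded. -/
theorem exists_mul_norm_detp_le {F : X →L[ℂ] X} (hF : IsFiniteRank F)
    (hinj : ∀ x, F x = x → x = 0) (p m : ℝ) :
    ∃ c, 0 < c ∧ ∀ G K : X →L[ℂ] X, IsFiniteRank G → IsFiniteRank K → G = F + K - F * K →
      ‖G‖ ≤ m → ‖K‖ ≤ m → c * ‖detp p K‖ ≤ ‖detp p G‖ := by
  choose C hC using fun k => hF.exists_norm_trOn_pow_mul_sub_le m k 1
  have hdet : detOneSub F ≠ 0 := by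
    rw [Ne, hF.detOneSub_eq_zero_iff]
    rintro ⟨x, hx0, hx⟩
    exact hx0 (hinj x hx)
  refine ⟨‖detOneSub F‖ * Real.exp (-∑ k ∈ Finset.Icc 1 (⌈p⌉₊ - 1), C k / k), by positivity,
    fun G K hG hK h hGm hKm => ?_⟩
  have hsum : ‖∑ k ∈ Finset.Icc 1 (⌈p⌉₊ - 1), trOn (G ^ k) / (k : ℂ) -
      ∑ k ∈ Finset.Icc 1 (⌈p⌉₊ - 1), trOn (K ^ k) / (k : ℂ)‖ ≤
      ∑ k ∈ Finset.Icc 1 (⌈p⌉₊ - 1), C k / k := by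
    rw [← Finset.sum_sub_distrib]
    refine norm_sum_le_of_le _ fun k _ => ?_
    rw [← sub_div, norm_div, Complex.norm_natCast]
    gcongr
    simpa only [mul_one] using hC k G K 1 hG hK h hGm hKm ContinuousLinearMap.norm_id_le
  have hre := (Complex.abs_re_le_norm _).trans hsum
  rw [Complex.sub_re, abs_le] at hre
  have hdetG : detOneSub G = detOneSub F * detOneSub K := h ▸ hF.detOneSub_mul hK
  rw [detp, detp, hdetG, norm_mul, norm_mul, norm_mul, Complex.norm_exp, Complex.norm_exp,
    mul_mul_mul_comm, ← Real.exp_add]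
  gcongr
  linarith [hre.1]

end IsFiniteRank

namespace LpIdeal

variable {p : ℝ} (I : LpIdeal p X) {K L : X →L[ℂ] X}

theorem sub_mem (hK : K ∈ I.carrier) (hL : L ∈ I.carrier) : K - L ∈ I.carrier := by
  rw [sub_eq_add_neg, ← neg_one_smul ℂ L]
  exact I.add_mem hK (I.smul_mem _ hL)

theorem norm'_sub_comm (hK : K ∈ I.carrier) (hL : L ∈ I.carrier) :
    I.norm' (K - L) = I.norm' (L - K) := by
  rw [← neg_sub L K, ← neg_one_smul ℂ (L - K), I.norm'_smul _ (I.sub_mem hL hK)]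
  simp

theorem norm'_mul_le_left (hL : L ∈ I.carrier) (A : X →L[ℂ] X) :
    I.norm' (A * L) ≤ ‖A‖ * I.norm' L := by
  have h := I.mul_norm'_le L hL A 1
  rw [mul_one] at h
  exact h.trans (mul_le_of_le_one_right (mul_nonneg (norm_nonneg _) (I.norm'_nonneg L hL))
    ContinuousLinearMap.norm_id_le)

theorem norm'_mul_le_right (hL : L ∈ I.carrier) (A : X →L[ℂ] X) :
    I.norm' (L * A) ≤ I.norm' L * ‖A‖ := by
  have h := I.mul_norm'_le L hL 1 A
  rw [one_mul] at h
  refine h.trans (mul_le_mul_of_nonneg_right ?_ (norm_nonneg _))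
  exact mul_le_of_le_one_left (I.norm'_nonneg L hL) ContinuousLinearMap.norm_id_le

theorem isCompactOperator (hL : L ∈ I.carrier) : IsCompactOperator L := by
  have hcl : IsClosed {T : X →L[ℂ] X | IsCompactOperator T} :=
    isClosed_setOfPred_isCompactOperator
  refine hcl.closure_subset (Metric.mem_closure_iff.2 fun ε hε => ?_)
  obtain ⟨F, hF, hFL⟩ := I.dense_finiteRank L hL ε hε
  refine ⟨F, hF.isCompactOperator, ?_⟩
  rw [dist_eq_norm]
  exact (I.opNorm_le _ (I.sub_mem hL (I.finiteRank_mem F hF))).trans_lt hFL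

/-- If `I - L` is not invertible, then `L` has a nonzero fixed vector. -/
theorem exists_apply_eq_self (hL : L ∈ I.carrier) (h : ¬ IsUnit (1 - L)) :
    ∃ x ≠ 0, L x = x := by
  rcases (I.isCompactOperator hL).hasEigenvalue_or_mem_resolventSet (one_ne_zero (α := ℂ)) with
    h1 | h1
  · obtain ⟨x, hx⟩ := h1.exists_hasEigenvector
    exact ⟨x, hx.2, by simpa using hx.apply_eq_smul⟩
  · rw [spectrum.mem_resolventSet_iff, map_one] at h1
    exact absurd h1 h

/-- A fixed vector of `L` can be kept when approximating `L` by finite rank operators. -/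
theorem exists_finiteRank_apply_eq_self (hL : L ∈ I.carrier) {x : X} (hx : x ≠ 0) (hLx : L x = x)
    {δ : ℝ} (hδ : 0 < δ) :
    ∃ F : X →L[ℂ] X, IsFiniteRank F ∧ F x = x ∧ I.norm' (F - L) < δ := by
  obtain ⟨φ, hφ⟩ := SeparatingDual.exists_eq_one (R := ℂ) hx
  let P : X →L[ℂ] X := φ.smulRight x
  have hP : IsFiniteRank P :=
    isFiniteRank_of_forall_mem (ℂ ∙ x) fun y => Submodule.smul_mem _ _
      (Submodule.mem_span_singleton_self x)
  have hPx : P x = x := by simp [P, hφ]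
  obtain ⟨F, hF, hFL⟩ := I.dense_finiteRank L hL (δ / (‖P - 1‖ + 1)) (by positivity)
  refine ⟨F + (L - F) * P, hF.add (hP.mul_left _), by simp [hPx, hLx], ?_⟩
  have hmem := I.sub_mem hL (I.finiteRank_mem F hF)
  rw [show F + (L - F) * P - L = (L - F) * (P - 1) by noncomm_ring]
  rw [lt_div_iff₀ (by positivity)] at hFL
  refine (I.norm'_mul_le_right hmem _).trans_lt (lt_of_le_of_lt ?_ hFL)
  gcongr
  · exact I.norm'_nonneg _ hmem
  · linarith

end LpIdeal

theorem detp_eq_zero_iff (p : ℝ) {F : X →L[ℂ] X} (hF : IsFiniteRank F) :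
    detp p F = 0 ↔ ∃ x ≠ 0, F x = x := by
  rw [← hF.detOneSub_eq_zero_iff, detp, mul_eq_zero, or_iff_left (Complex.exp_ne_zero _)]

theorem isUnit_one_sub_of_ne_zero {p : ℝ} (I : LpIdeal p X) {D : (X →L[ℂ] X) → ℂ}
    (hDc : IdealContinuous I D) (hDe : ExtendsDetp p D) {L : X →L[ℂ] X} (hL : L ∈ I.carrier)
    (hD : D L ≠ 0) : IsUnit (1 - L) := by
  by_contra hu
  obtain ⟨x, hx, hLx⟩ := I.exists_apply_eq_self hL hu
  obtain ⟨δ, hδ, hδD⟩ := hDc L hL ‖D L‖ (norm_pos_iff.2 hD)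
  obtain ⟨F, hF, hFx, hFL⟩ := I.exists_finiteRank_apply_eq_self hL hx hLx hδ
  have h := hδD F (I.finiteRank_mem F hF) hFL
  rw [hDe F hF, (detp_eq_zero_iff p hF).2 ⟨x, hx, hFx⟩, zero_sub, norm_neg] at h
  exact lt_irrefl _ h

/-- If `I - L` is invertible, then so is `I - F` for `F` close to `L`, with a uniform bound on the
inverse. -/
theorem exists_inverse_one_sub_norm_le {R : Type*} [NormedRing R] [CompleteSpace R] {a : R}
    (h : IsUnit (1 - a)) :
    ∃ M ε : ℝ, 0 < M ∧ 0 < ε ∧ ∀ b, ‖a - b‖ < ε →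
      ∃ c, ‖c‖ ≤ M ∧ c * (1 - b) = 1 ∧ (1 - b) * c = 1 := by
  obtain ⟨u, hu⟩ := h
  have hc : ContinuousAt (fun b : R => 1 - b) a := by fun_prop
  have hc' : ContinuousAt (fun b => Ring.inverse (1 - b)) a :=
    ContinuousAt.comp (g := Ring.inverse) (hu ▸ NormedRing.inverse_continuousAt u) hc
  have hunit : ∀ᶠ b in nhds a, IsUnit (1 - b) :=
    hc.tendsto.eventually (show ∀ᶠ c in nhds (1 - a), IsUnit c from hu ▸ Units.nhds u)
  have hbound : ∀ᶠ b in nhds a, ‖Ring.inverse (1 - b)‖ < ‖Ring.inverse (1 - a)‖ + 1 :=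
    hc'.norm.eventually_lt continuousAt_const (lt_add_one _)
  obtain ⟨ε, hε, hεb⟩ := Metric.eventually_nhds_iff.1 (hunit.and hbound)
  refine ⟨‖Ring.inverse (1 - a)‖ + 1, ε, by positivity, hε, fun b hb => ?_⟩
  rw [← dist_eq_norm, dist_comm] at hb
  obtain ⟨h₁, h₂⟩ := hεb hb
  exact ⟨_, h₂.le, Ring.inverse_mul_cancel _ h₁, Ring.mul_inverse_cancel _ h₁⟩

theorem ne_zero_of_isUnit_one_sub {p : ℝ} (I : LpIdeal p X) {D : (X →L[ℂ] X) → ℂ}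
    (hDc : IdealContinuous I D) (hDe : ExtendsDetp p D) {L : X →L[ℂ] X} (hL : L ∈ I.carrier)
    (hu : IsUnit (1 - L)) : D L ≠ 0 := by
  intro hDL
  obtain ⟨M, ε, hM, hε, hinv⟩ := exists_inverse_one_sub_norm_le hu
  have hq : 0 < I.q := one_pos.trans_le I.one_le_q
  have h0 : IsFiniteRank (0 : X →L[ℂ] X) := isFiniteRank_of_forall_mem ⊥ fun _ => rfl
  have hD0 : 0 < ‖D 0‖ := by
    rw [norm_pos_iff, hDe 0 h0, Ne, detp_eq_zero_iff p h0]
    rintro ⟨x, hx, hx'⟩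
    exact hx hx'.symm
  obtain ⟨δ₀, hδ₀, hD₀⟩ := hDc 0 (I.finiteRank_mem 0 h0) (‖D 0‖ / 2) (by positivity)
  obtain ⟨η, hη, hηδ⟩ : ∃ η : ℝ, 0 < η ∧ M * (I.q * (η + η)) ≤ δ₀ :=
    ⟨δ₀ / (2 * M * I.q), by positivity, le_of_eq (by field_simp; ring)⟩
  obtain ⟨F, hF, hFL⟩ := I.dense_finiteRank L hL (min ε η) (by positivity)
  obtain ⟨hFε, hFη⟩ := lt_min_iff.1 hFL
  have hFI := I.finiteRank_mem F hF
  obtain ⟨R, hRM, hR, hR'⟩ := hinv F ((I.opNorm_le _ (I.sub_mem hL hFI)).trans_lt hFε)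
  have hinj : ∀ x, F x = x → x = 0 := fun x hx => by
    have := congrArg (fun T : X →L[ℂ] X => T x) hR
    simpa [hx] using this.symm
  obtain ⟨c, hc, hcle⟩ := hF.exists_mul_norm_detp_le hinj p (‖L‖ + η + δ₀)
  obtain ⟨δ₁, hδ₁, hD₁⟩ := hDc L hL (c * (‖D 0‖ / 2)) (by positivity)
  obtain ⟨G, hG, hGL⟩ := I.dense_finiteRank L hL (min η δ₁) (by positivity)
  obtain ⟨hGη, hGδ⟩ := lt_min_iff.1 hGL
  have hGI := I.finiteRank_mem G hG
  have hK : IsFiniteRank (R * (G - F)) := (hG.sub hF).mul_left R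
  have hKI := I.finiteRank_mem _ hK
  have hGF : I.norm' (G - F) < I.q * (η + η) := by
    have h := I.norm'_add_le (G - L) (I.sub_mem hGI hL) (L - F) (I.sub_mem hL hFI)
    rw [sub_add_sub_cancel, I.norm'_sub_comm hGI hL] at h
    exact h.trans_lt (by gcongr)
  have hKδ : I.norm' (R * (G - F)) < δ₀ := by
    have hGFI := I.sub_mem hGI hFI
    calc I.norm' (R * (G - F)) ≤ ‖R‖ * I.norm' (G - F) := I.norm'_mul_le_left hGFI R
      _ ≤ M * I.norm' (G - F) := mul_le_mul_of_nonneg_right hRM (I.norm'_nonneg _ hGFI)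
      _ < M * (I.q * (η + η)) := by gcongr
      _ ≤ δ₀ := hηδ
  have hGK : G = F + R * (G - F) - F * (R * (G - F)) := by
    have : (1 - F) * (R * (G - F)) = G - F := by rw [← mul_assoc, hR', one_mul]
    rw [add_sub_assoc, ← one_sub_mul, this, add_sub_cancel]
  have hGm : ‖G‖ ≤ ‖L‖ + η + δ₀ := by
    have h := (I.opNorm_le _ (I.sub_mem hL hGI)).trans_lt hGη
    linarith [norm_le_norm_add_norm_sub L G]
  have hKm : ‖R * (G - F)‖ ≤ ‖L‖ + η + δ₀ := by
    linarith [I.opNorm_le _ hKI, norm_nonneg L]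
  have hle := hcle G _ hG hK hGK hGm hKm
  rw [← hDe G hG, ← hDe _ hK] at hle
  have h₀ := hD₀ _ hKI (by rwa [sub_zero])
  have h₁ := hD₁ G hGI (by rwa [I.norm'_sub_comm hGI hL])
  rw [hDL, sub_zero] at h₁
  have h₂ : ‖D (R * (G - F))‖ < ‖D 0‖ / 2 := lt_of_mul_lt_mul_left (hle.trans_lt h₁) hc.le
  have h₃ := norm_sub_norm_le (D 0) (D (R * (G - F)))
  rw [norm_sub_rev] at h₃
  linarith

/-- Let `I` be an `l_p`-ideal in `B(X)` and let `D` be the (unique)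
`‖·‖_I`-continuous function with `D F = det_p(I-F)` for all finite rank `F`.  Then for
`L ∈ I`, `det_{p,I}(I-L) ≠ 0` if and only if `I - L` is invertible in `B(X)`. -/
theorem detpIdeal_ne_zero_iff (p : ℝ) (hp : 0 < p) (I : LpIdeal p X)
    (D : (X →L[ℂ] X) → ℂ) (hDc : IdealContinuous I D) (hDe : ExtendsDetp p D)
    (L : X →L[ℂ] X) (hL : L ∈ I.carrier) :
    D L ≠ 0 ↔ IsUnit ((1 : X →L[ℂ] X) - L) := by
  exact ⟨isUnit_one_sub_of_ne_zero I hDc hDe hL, ne_zero_of_isUnit_one_sub I hDc hDe hL⟩
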